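/- arXiv:2404.19681 — 2 statements merged into one kernel-verified Lean document; each statement's English description precedes it below -/
import Mathlib

section
/- Let X be a proper metric space, ρ ∈ X, and let A, A₁, A₂, … be closed subsets of X. Define D_ρ as the local Hausdorff distance with basepoint ρ. Then D_ρ(A_n, A) → 0 as n → ∞ if and only if both of the following hold: (upper) for every strictly increasing sequence (n_k) of indices and every choice of points x_k ∈ A_{n_k} converging to some y ∈ X, one has y ∈ A; (lower) for every y ∈ A there exists a sequence (x_n) in X with x_n ∈ A_n for all sufficiently large n and x_n → y. (That is, convergence in the local Hausdorff metric is exactly convergence of closed sets in the Fell/Painlevé–Kuratowski sense.) -/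
open Metric Set MeasureTheory Filter
open scoped ENNReal Topology

/-- The local Hausdorff distance with basepoint `ρ` between closed subsets of a metric
space: `D_ρ(A,B) := ∫_{(0,∞)} e^{-r} · min(1, dHe(A ∩ B̄(ρ,r), B ∩ B̄(ρ,r))) dr`,
with values in `ℝ≥0∞`. -/
noncomputable def localHausdorffDist {X : Type*} [PseudoMetricSpace X] (ρ : X)
    (A B : Set X) : ℝ≥0∞ :=
  ∫⁻ r in Set.Ioi (0 : ℝ),
    ENNReal.ofReal (Real.exp (-r)) *
      min 1 (EMetric.hausdorffEdist (A ∩ Metric.closedBall ρ r) (B ∩ Metric.closedBall ρ r))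

theorem localHausdorffDist_eq_lintegral_hausdorffEDist {X : Type*} [PseudoMetricSpace X]
    (ρ : X) (A B : Set X) :
    localHausdorffDist ρ A B = ∫⁻ r in Ioi (0 : ℝ), ENNReal.ofReal (Real.exp (-r)) *
      min 1 (hausdorffEDist (A ∩ closedBall ρ r) (B ∩ closedBall ρ r)) :=
  rfl

theorem localHausdorffDist_comm {X : Type*} [PseudoMetricSpace X] (ρ : X) (A B : Set X) :
    localHausdorffDist ρ A B = localHausdorffDist ρ B A := by
  simp only [localHausdorffDist_eq_lintegral_hausdorffEDist, hausdorffEDist_comm]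

/-- A point of `A` in the ball of radius `R` that is far from `B` forces the local Hausdorff
distance between `A` and `B` to be large. -/
theorem mul_min_infEDist_le_localHausdorffDist {X : Type*} [PseudoMetricSpace X] {ρ x : X}
    {A B : Set X} {R : ℝ} (hR : 0 ≤ R) (hx : x ∈ A) (hxR : dist x ρ ≤ R) :
    ENNReal.ofReal (Real.exp (-(R + 1))) * min 1 (infEDist x B) ≤ localHausdorffDist ρ A B := by
  rw [localHausdorffDist_eq_lintegral_hausdorffEDist]
  calc ENNReal.ofReal (Real.exp (-(R + 1))) * min 1 (infEDist x B)
      = ∫⁻ _ in Ioc R (R + 1), ENNReal.ofReal (Real.exp (-(R + 1))) * min 1 (infEDist x B) := by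
        simp
    _ ≤ ∫⁻ r in Ioc R (R + 1), ENNReal.ofReal (Real.exp (-r)) *
          min 1 (hausdorffEDist (A ∩ closedBall ρ r) (B ∩ closedBall ρ r)) := by
        refine setLIntegral_mono' measurableSet_Ioc fun r hr => ?_
        have hle : infEDist x B ≤
            hausdorffEDist (A ∩ closedBall ρ r) (B ∩ closedBall ρ r) :=
          (infEDist_anti inter_subset_left).trans
            (infEDist_le_hausdorffEDist_of_mem ⟨hx, hxR.trans hr.1.le⟩)
        have hr' : -(R + 1) ≤ -r := neg_le_neg hr.2
        gcongr
    _ ≤ _ := lintegral_mono_set fun r hr => hR.trans_lt hr.1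

theorem eventually_forall_infEDist_lt_of_tendsto_localHausdorffDist {X ι : Type*}
    [PseudoMetricSpace X] {ρ : X} {l : Filter ι} {As Bs : ι → Set X}
    (h : Tendsto (fun i => localHausdorffDist ρ (As i) (Bs i)) l (𝓝 0)) (R : ℝ)
    {ε : ℝ≥0∞} (hε : 0 < ε) :
    ∀ᶠ i in l, ∀ x ∈ As i, dist x ρ ≤ R → infEDist x (Bs i) < ε := by
  have hpos : 0 < ENNReal.ofReal (Real.exp (-(|R| + 1))) * min 1 ε :=
    ENNReal.mul_pos (by simp [Real.exp_pos]) (by simp [hε.ne'])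
  filter_upwards [h.eventually_lt_const hpos] with i hi x hx hxR
  by_contra! hle
  refine hi.not_ge (le_trans ?_ (mul_min_infEDist_le_localHausdorffDist (abs_nonneg R) hx
    (hxR.trans (le_abs_self R))))
  gcongr

/-- For all but countably many radii `r`, the points of `A` in the closed ball of radius `r` are
limits of points of `A` in the open ball. -/
theorem countable_setOf_not_inter_closedBall_subset_closure {X : Type*} [PseudoMetricSpace X]
    [SecondCountableTopology X] (ρ : X) (A : Set X) :
    {r : ℝ | ¬ A ∩ closedBall ρ r ⊆ closure (A ∩ ball ρ r)}.Countable := by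
  refine ((TopologicalSpace.countable_countableBasis X).image
    fun U => sInf ((fun x => dist x ρ) '' (A ∩ U))).mono fun r hr => ?_
  obtain ⟨y, ⟨hyA, hyr⟩, hy⟩ := not_subset.1 hr
  obtain ⟨U, hU, hyU, hUs⟩ := (TopologicalSpace.isBasis_countableBasis X).exists_subset_of_mem_open
    (show y ∈ (closure (A ∩ ball ρ r))ᶜ from hy) isClosed_closure.isOpen_compl
  have hge : ∀ z ∈ A ∩ U, r ≤ dist z ρ := fun z hz => by
    by_contra! hlt
    exact hUs hz.2 (subset_closure ⟨hz.1, hlt⟩)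
  have hyr' : dist y ρ = r := le_antisymm hyr (hge y ⟨hyA, hyU⟩)
  refine ⟨U, hU, IsLeast.csInf_eq ⟨⟨y, ⟨hyA, hyU⟩, hyr'⟩, ?_⟩⟩
  rintro _ ⟨z, hz, rfl⟩
  exact hge z hz

/-- If every limit along a subsequence of points of `As n` lies in `A`, then the parts of `As n` in
a compact set `K` are eventually uniformly close to `A ∩ K`. -/
theorem eventually_forall_infEDist_le_of_subseq_limits_mem {X : Type*} [PseudoMetricSpace X]
    {A K : Set X} (hK : IsCompact K) {As : ℕ → Set X}
    (h : ∀ φ : ℕ → ℕ, StrictMono φ → ∀ x : ℕ → X, (∀ k, x k ∈ As (φ k)) →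
      ∀ y : X, Tendsto x atTop (𝓝 y) → y ∈ A)
    {ε : ℝ≥0∞} (hε : 0 < ε) :
    ∀ᶠ n in atTop, ∀ x ∈ As n ∩ K, infEDist x (A ∩ K) ≤ ε := by
  by_contra hcon
  obtain ⟨φ, hφ, hφ'⟩ := extraction_of_frequently_atTop (not_eventually.1 hcon)
  push Not at hφ'
  choose x hx hxε using hφ'
  obtain ⟨y, hyK, ψ, hψ, hy⟩ := hK.tendsto_subseq fun k => (hx k).2
  have hyA : y ∈ A := h (φ ∘ ψ) (hφ.comp hψ) (x ∘ ψ) (fun k => (hx (ψ k)).1) y hy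
  have hlim : ε ≤ infEDist y (A ∩ K) :=
    ge_of_tendsto' ((continuous_infEDist.tendsto y).comp hy) fun k => (hxε (ψ k)).le
  exact hε.not_ge (hlim.trans_eq (infEDist_zero_of_mem ⟨hyA, hyK⟩))

/-- If the points of a set dense in a compact set `K` are limits of points of `Bs n`, then `K` is
eventually uniformly close to `Bs n`. -/
theorem eventually_forall_infEDist_le_of_subset_closure {X : Type*} [PseudoMetricSpace X]
    {K S : Set X} (hK : IsCompact K) (hKS : K ⊆ closure S) {Bs : ℕ → Set X}
    (h : ∀ z ∈ S, ∃ x : ℕ → X, (∀ᶠ n in atTop, x n ∈ Bs n) ∧ Tendsto x atTop (𝓝 z))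
    {ε : ℝ≥0∞} (hε : 0 < ε) :
    ∀ᶠ n in atTop, ∀ y ∈ K, infEDist y (Bs n) ≤ ε := by
  by_contra hcon
  obtain ⟨φ, hφ, hφ'⟩ := extraction_of_frequently_atTop (not_eventually.1 hcon)
  push Not at hφ'
  choose y hyK hyε using hφ'
  obtain ⟨w, hwK, ψ, hψ, hw⟩ := hK.tendsto_subseq hyK
  obtain ⟨z, hzS, hwz⟩ := EMetric.mem_closure_iff.1 (hKS hwK) ε hε
  obtain ⟨x, hxB, hxz⟩ := h z hzS
  have hsub : Tendsto (φ ∘ ψ) atTop atTop := (hφ.comp hψ).tendsto_atTop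
  obtain ⟨k, hkε, hkB⟩ := (((hw.edist (hxz.comp hsub)).eventually_lt_const hwz).and
    (hsub.eventually hxB)).exists
  exact (hyε (ψ k)).not_ge ((infEDist_le_edist_of_mem hkB).trans hkε.le)

/-- Dominated convergence to zero for the lower Lebesgue integral, with no measurability assumption
on the functions. -/
theorem tendsto_lintegral_zero_of_dominated {α : Type*} [MeasurableSpace α] {μ : Measure α}
    {F : ℕ → α → ℝ≥0∞} (bound : α → ℝ≥0∞) (h_bound : ∀ n, F n ≤ bound)
    (h_fin : ∫⁻ a, bound a ∂μ ≠ ∞) (h_lim : ∀ᵐ a ∂μ, Tendsto (fun n => F n a) atTop (𝓝 0)) :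
    Tendsto (fun n => ∫⁻ a, F n a ∂μ) atTop (𝓝 0) := by
  choose g hgm hgF hg using fun n => exists_measurable_le_lintegral_eq μ (F n)
  simp only [hg]
  rw [← lintegral_zero (μ := μ)]
  refine tendsto_lintegral_of_dominated_convergence bound hgm
    (fun n => ae_of_all _ ((hgF n).trans (h_bound n))) h_fin ?_
  filter_upwards [h_lim] with a ha
  exact tendsto_of_tendsto_of_tendsto_of_le_of_le tendsto_const_nhds ha
    (fun _ => zero_le) fun n => hgF n a

/-- **Convergence in the local Hausdorff metric is exactly Fell/Painlevé–Kuratowski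
convergence of closed sets**: `D_ρ(A_n, A) → 0` iff (upper) any limit of points
`x_k ∈ A_{n_k}` along a subsequence belongs to `A`, and (lower) every point of `A`
is the limit of points `x_n ∈ A_n` (for all sufficiently large `n`). -/
theorem localHausdorffDist_tendsto_iff_fell
    {X : Type*} [MetricSpace X] [ProperSpace X] (ρ : X)
    (A : Set X) (hA : IsClosed A) (As : ℕ → Set X) (hAs : ∀ n, IsClosed (As n)) :
    Tendsto (fun n => localHausdorffDist ρ (As n) A) atTop (𝓝 0) ↔
      ((∀ φ : ℕ → ℕ, StrictMono φ → ∀ x : ℕ → X, (∀ k, x k ∈ As (φ k)) →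
          ∀ y : X, Tendsto x atTop (𝓝 y) → y ∈ A) ∧
       (∀ y ∈ A, ∃ x : ℕ → X, (∀ᶠ n in atTop, x n ∈ As n) ∧ Tendsto x atTop (𝓝 y))) := by
  constructor
  · intro h
    constructor
    · intro φ hφ x hx y hy
      rw [mem_iff_infEDist_zero_of_closed hA, ← nonpos_iff_eq_zero]
      refine le_of_forall_gt_imp_ge_of_dense fun ε hε => ?_
      have hclose : ∀ᶠ k in atTop, infEDist (x k) A ≤ ε := by
        filter_upwards [hφ.tendsto_atTop.eventually
            (eventually_forall_infEDist_lt_of_tendsto_localHausdorffDist h (dist y ρ + 1) hε),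
          (hy.dist tendsto_const_nhds).eventually_le_const (lt_add_one (dist y ρ))] with k hk hk'
        exact (hk (x k) (hx k) hk').le
      exact le_of_tendsto ((continuous_infEDist.tendsto y).comp hy) hclose
    · intro y hy
      simp only [localHausdorffDist_comm ρ _ A] at h
      have hclose : ∀ ε : ℝ≥0∞, 0 < ε → ∀ᶠ n in atTop, infEDist y (As n) < ε := fun ε hε =>
        (eventually_forall_infEDist_lt_of_tendsto_localHausdorffDist h (dist y ρ) hε).mono
          fun n hn => hn y hy le_rfl
      have hnear : ∀ n, ∃ x, (As n).Nonempty → x ∈ As n ∧ infDist y (As n) = dist y x := by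
        intro n
        by_cases hn : (As n).Nonempty
        · obtain ⟨x, hx⟩ := (hAs n).exists_infDist_eq_dist hn y
          exact ⟨x, fun _ => hx⟩
        · exact ⟨y, fun hn' => absurd hn' hn⟩
      choose x hx using hnear
      have hne : ∀ᶠ n in atTop, (As n).Nonempty := by
        filter_upwards [hclose 1 one_pos] with n hn
        obtain ⟨z, hz, -⟩ := infEDist_lt_iff.1 hn
        exact ⟨z, hz⟩
      refine ⟨x, hne.mono fun n hn => (hx n hn).1, ?_⟩
      rw [Metric.tendsto_nhds]
      intro ε hε
      filter_upwards [hne, hclose _ (ENNReal.ofReal_pos.2 hε)] with n hn hnε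
      rw [dist_comm, ← (hx n hn).2]
      exact (ENNReal.lt_ofReal_iff_toReal_lt (infEDist_ne_top hn)).1 hnε
  · rintro ⟨hupper, hlower⟩
    simp only [localHausdorffDist_eq_lintegral_hausdorffEDist]
    refine tendsto_lintegral_zero_of_dominated (fun r => ENNReal.ofReal (Real.exp (-r)))
      (fun n r => mul_le_of_le_one_right' (min_le_left _ _)) ?_ ?_
    · exact (integrableOn_exp_neg_Ioi 0).lintegral_lt_top.ne
    · filter_upwards [ae_restrict_of_ae (s := Ioi 0)
        ((countable_setOf_not_inter_closedBall_subset_closure ρ A).ae_notMem volume)] with r hr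
      have hr : A ∩ closedBall ρ r ⊆ closure (A ∩ ball ρ r) := not_not.1 hr
      have hlim : Tendsto (fun n => hausdorffEDist (As n ∩ closedBall ρ r) (A ∩ closedBall ρ r))
          atTop (𝓝 0) := by
        rw [ENNReal.tendsto_nhds_zero]
        intro ε hε
        have hball : ∀ z ∈ A ∩ ball ρ r, ∃ x : ℕ → X,
            (∀ᶠ n in atTop, x n ∈ As n ∩ closedBall ρ r) ∧ Tendsto x atTop (𝓝 z) := by
          rintro z ⟨hzA, hzr⟩
          obtain ⟨x, hx, hxz⟩ := hlower z hzA
          exact ⟨x, hx.and ((hxz.eventually (isOpen_ball.mem_nhds hzr)).mono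
            fun n hn => ball_subset_closedBall hn), hxz⟩
        filter_upwards [eventually_forall_infEDist_le_of_subseq_limits_mem
            (isCompact_closedBall ρ r) hupper hε,
          eventually_forall_infEDist_le_of_subset_closure
            ((isCompact_closedBall ρ r).inter_left hA) hr hball hε] with n h₁ h₂
        exact hausdorffEDist_le_of_infEDist h₁ h₂
      have hmin : Tendsto (fun n => min 1
          (hausdorffEDist (As n ∩ closedBall ρ r) (A ∩ closedBall ρ r))) atTop (𝓝 0) :=
        tendsto_of_tendsto_of_tendsto_of_le_of_le tendsto_const_nhds hlim
          (fun _ => zero_le) fun _ => min_le_right _ _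
      simpa using ENNReal.Tendsto.const_mul hmin (Or.inr ENNReal.ofReal_ne_top)
end

section
/- Let X, Y, M₁, M₂ be proper metric spaces equipped with their Borel σ-algebras, let f₁ : X → M₁, f₂ : X → M₂, g₁ : Y → M₁, g₂ : Y → M₂ be isometric embeddings, and let ε ≥ 0 satisfy dist(f₂(x), g₂(y)) ≤ dist(f₁(x), g₁(y)) + ε for all x ∈ X, y ∈ Y. Then for every Borel measure μ on X finite on compact sets, x ∈ X, Borel measure ν on Y finite on compact sets, and y ∈ Y, one has, with values in [0,∞], max( dist(f₂(x), g₂(y)), ∫_{(0,∞)} e^{−r} · min(1, dLPe(((f₂)_*μ)|B̄(f₂(x),r), ((g₂)_*ν)|B̄(g₂(y),r))) dr ) ≤ max( dist(f₁(x), g₁(y)), ∫_{(0,∞)} e^{−r} · min(1, dLPe(((f₁)_*μ)|B̄(f₁(x),r), ((g₁)_*ν)|B̄(g₁(y),r))) dr ) + ε. -/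
open Metric Set MeasureTheory Filter
open scoped ENNReal

/-- The rooted vague distance (with values in `ℝ≥0∞`) between pairs
`(Radon measure, basepoint)` in a metric space: the maximum of the distance between
the basepoints and
`∫_{(0,∞)} e^{-r} · min(1, dLPe(μ|B̄(x,r), ν|B̄(y,r))) dr`,
where `dLPe` is the `ℝ≥0∞`-valued Lévy–Prokhorov distance. -/
noncomputable def rootedVagueEDist {M : Type*} [PseudoMetricSpace M] [MeasurableSpace M]
    (μ : Measure M) (x : M) (ν : Measure M) (y : M) : ℝ≥0∞ :=
  max (edist x y)
    (∫⁻ r in Set.Ioi (0 : ℝ),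
      ENNReal.ofReal (Real.exp (-r)) *
        min 1 (levyProkhorovEDist (μ.restrict (Metric.closedBall x r))
          (ν.restrict (Metric.closedBall y r))))

/-- If `f₂ x` and `g₂ y` are never more than `ε` further apart than `f₁ x` and `g₁ y`, then a
thickening estimate between the pushforwards under `f₁`, `g₁` passes to those under `f₂`, `g₂`,
at the cost of thickening by `ε` more. -/
lemma map_apply_le_map_thickening_add {X Y M₁ M₂ : Type*}
    [MeasurableSpace X] [MeasurableSpace Y]
    [PseudoMetricSpace M₁] [MeasurableSpace M₁] [OpensMeasurableSpace M₁]
    [PseudoMetricSpace M₂] [MeasurableSpace M₂] [OpensMeasurableSpace M₂]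
    {f₁ : X → M₁} {f₂ : X → M₂} {g₁ : Y → M₁} {g₂ : Y → M₂}
    (hf₁ : MeasurableEmbedding f₁) (hf₂ : Measurable f₂) (hg₁ : Measurable g₁)
    (hg₂ : Measurable g₂) {ε : ℝ}
    (h : ∀ x y, dist (f₂ x) (g₂ y) ≤ dist (f₁ x) (g₁ y) + ε)
    {μ : Measure X} {ν : Measure Y} {c : ℝ≥0∞} {δ : ℝ}
    (hc : ∀ A, MeasurableSet A → μ.map f₁ A ≤ ν.map g₁ (thickening δ A) + c)
    {B : Set M₂} (hB : MeasurableSet B) :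
    μ.map f₂ B ≤ ν.map g₂ (thickening (δ + ε) B) + c := by
  have hA := hc _ (hf₁.measurableSet_image.2 (hf₂ hB))
  rw [hf₁.map_apply, preimage_image_eq _ hf₁.injective,
    Measure.map_apply hg₁ isOpen_thickening.measurableSet] at hA
  rw [Measure.map_apply hf₂ hB, Measure.map_apply hg₂ isOpen_thickening.measurableSet]
  refine hA.trans (add_le_add_left (measure_mono fun y hy ↦ ?_) c)
  obtain ⟨_, ⟨x, hx, rfl⟩, hxy⟩ := mem_thickening_iff.1 hy
  refine mem_thickening_iff.2 ⟨f₂ x, hx, ?_⟩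
  rw [dist_comm] at hxy ⊢
  linarith [h x y]

/-- Stability of the Lévy–Prokhorov distance of pushforwards under ε-deformations of the ambient
space. -/
lemma levyProkhorovEDist_map_le_of_dist_le {X Y M₁ M₂ : Type*}
    [MeasurableSpace X] [MeasurableSpace Y]
    [PseudoMetricSpace M₁] [MeasurableSpace M₁] [OpensMeasurableSpace M₁]
    [PseudoMetricSpace M₂] [MeasurableSpace M₂] [OpensMeasurableSpace M₂]
    {f₁ : X → M₁} {f₂ : X → M₂} {g₁ : Y → M₁} {g₂ : Y → M₂}
    (hf₁ : MeasurableEmbedding f₁) (hf₂ : Measurable f₂) (hg₁ : MeasurableEmbedding g₁)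
    (hg₂ : Measurable g₂) {ε : ℝ} (hε : 0 ≤ ε)
    (h : ∀ x y, dist (f₂ x) (g₂ y) ≤ dist (f₁ x) (g₁ y) + ε)
    (μ : Measure X) (ν : Measure Y) :
    levyProkhorovEDist (μ.map f₂) (ν.map g₂)
      ≤ levyProkhorovEDist (μ.map f₁) (ν.map g₁) + ENNReal.ofReal ε := by
  by_cases htop : levyProkhorovEDist (μ.map f₁) (ν.map g₁) = ∞
  · simp [htop]
  refine levyProkhorovEDist_le_of_forall_add_pos_le _ _ _ fun η B hη hη' hB ↦ ?_
  set c := levyProkhorovEDist (μ.map f₁) (ν.map g₁) + η with hc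
  have hlt : levyProkhorovEDist (μ.map f₁) (ν.map g₁) < c := ENNReal.lt_add_right htop hη.ne'
  have hct : c ≠ ∞ := ENNReal.add_ne_top.2 ⟨htop, hη'.ne⟩
  have hreal : (c + ENNReal.ofReal ε).toReal = c.toReal + ε := by
    rw [ENNReal.toReal_add hct ENNReal.ofReal_ne_top, ENNReal.toReal_ofReal hε]
  have hsum : levyProkhorovEDist (μ.map f₁) (ν.map g₁) + (ENNReal.ofReal ε + η)
      = c + ENNReal.ofReal ε := by rw [hc, add_right_comm, add_assoc]
  simp only [add_assoc (levyProkhorovEDist _ _), add_assoc ((_ : Measure M₂) _), hsum, hreal]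
  have hle : c ≤ c + ENNReal.ofReal ε := le_self_add
  constructor
  · exact (map_apply_le_map_thickening_add hf₁ hf₂ hg₁.measurable hg₂ h
      (fun A hA ↦ left_measure_le_of_levyProkhorovEDist_lt hlt hA) hB).trans
        (add_le_add_right hle _)
  · exact (map_apply_le_map_thickening_add hg₁ hg₂ hf₁.measurable hf₂
      (fun y x ↦ by simpa only [dist_comm] using h x y)
      (fun A hA ↦ right_measure_le_of_levyProkhorovEDist_lt hlt hA) hB).trans
        (add_le_add_right hle _)

lemma Isometry.map_restrict_closedBall {X M : Type*}
    [PseudoMetricSpace X] [MeasurableSpace X] [OpensMeasurableSpace X]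
    [PseudoMetricSpace M] [MeasurableSpace M] [BorelSpace M]
    {f : X → M} (hf : Isometry f) (μ : Measure X) (x : X) (r : ℝ) :
    (μ.map f).restrict (closedBall (f x) r) = (μ.restrict (closedBall x r)).map f := by
  rw [Measure.restrict_map hf.continuous.measurable measurableSet_closedBall,
    hf.preimage_closedBall]

lemma lintegral_exp_neg_Ioi_zero :
    ∫⁻ r in Ioi (0 : ℝ), ENNReal.ofReal (Real.exp (-r)) = 1 := by
  rw [← ofReal_integral_eq_lintegral_ofReal (integrableOn_exp_neg_Ioi 0)
    (ae_of_all _ fun _ ↦ (Real.exp_pos _).le), integral_exp_neg_Ioi_zero, ENNReal.ofReal_one]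

/-- **Stability of the rooted vague distance under ε-deformations of the ambient
space.** If `f₁, f₂, g₁, g₂` are isometric embeddings of proper metric spaces with
`dist (f₂ x) (g₂ y) ≤ dist (f₁ x) (g₁ y) + ε` for all `x, y`, then for Borel measures
`μ` on `X` and `ν` on `Y`, finite on compact sets, and basepoints `x ∈ X`, `y ∈ Y`,
the rooted vague distance of the pushforwards in `M₂` is at most that in `M₁` plus `ε`. -/
theorem rootedVagueEDist_map_le_of_dist_le
    {X Y M₁ M₂ : Type*}
    [MetricSpace X] [ProperSpace X] [MeasurableSpace X] [BorelSpace X]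
    [MetricSpace Y] [ProperSpace Y] [MeasurableSpace Y] [BorelSpace Y]
    [MetricSpace M₁] [ProperSpace M₁] [MeasurableSpace M₁] [BorelSpace M₁]
    [MetricSpace M₂] [ProperSpace M₂] [MeasurableSpace M₂] [BorelSpace M₂]
    {f₁ : X → M₁} {f₂ : X → M₂} {g₁ : Y → M₁} {g₂ : Y → M₂}
    (hf₁ : Isometry f₁) (hf₂ : Isometry f₂) (hg₁ : Isometry g₁) (hg₂ : Isometry g₂)
    {ε : ℝ} (hε : 0 ≤ ε)
    (h : ∀ (x : X) (y : Y), dist (f₂ x) (g₂ y) ≤ dist (f₁ x) (g₁ y) + ε)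
    (μ : Measure X) (hμ : ∀ K : Set X, IsCompact K → μ K < ⊤) (x : X)
    (ν : Measure Y) (hν : ∀ K : Set Y, IsCompact K → ν K < ⊤) (y : Y) :
    rootedVagueEDist (μ.map f₂) (f₂ x) (ν.map g₂) (g₂ y)
      ≤ rootedVagueEDist (μ.map f₁) (f₁ x) (ν.map g₁) (g₁ y) + ENNReal.ofReal ε := by
  have hLP (r : ℝ) :
      levyProkhorovEDist ((μ.map f₂).restrict (closedBall (f₂ x) r))
          ((ν.map g₂).restrict (closedBall (g₂ y) r))
        ≤ levyProkhorovEDist ((μ.map f₁).restrict (closedBall (f₁ x) r))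
          ((ν.map g₁).restrict (closedBall (g₁ y) r)) + ENNReal.ofReal ε := by
    simp only [hf₁.map_restrict_closedBall, hf₂.map_restrict_closedBall,
      hg₁.map_restrict_closedBall, hg₂.map_restrict_closedBall]
    exact levyProkhorovEDist_map_le_of_dist_le hf₁.isClosedEmbedding.measurableEmbedding
      hf₂.continuous.measurable hg₁.isClosedEmbedding.measurableEmbedding
      hg₂.continuous.measurable hε h _ _
  refine max_le ?_ ?_
  · calc edist (f₂ x) (g₂ y) ≤ edist (f₁ x) (g₁ y) + ENNReal.ofReal ε := by
          rw [edist_dist, edist_dist, ← ENNReal.ofReal_add dist_nonneg hε]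
          exact ENNReal.ofReal_le_ofReal (h x y)
      _ ≤ _ := by gcongr; exact le_max_left _ _
  · calc
      _ ≤ ∫⁻ r in Ioi (0 : ℝ), (ENNReal.ofReal (Real.exp (-r)) *
            min 1 (levyProkhorovEDist ((μ.map f₁).restrict (closedBall (f₁ x) r))
              ((ν.map g₁).restrict (closedBall (g₁ y) r)))
            + ENNReal.ofReal (Real.exp (-r)) * ENNReal.ofReal ε) := by
          refine lintegral_mono fun r ↦ ?_
          rw [← mul_add, min_add]
          gcongr
          exacts [le_self_add, hLP r]
      _ = (∫⁻ r in Ioi (0 : ℝ), ENNReal.ofReal (Real.exp (-r)) *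
            min 1 (levyProkhorovEDist ((μ.map f₁).restrict (closedBall (f₁ x) r))
              ((ν.map g₁).restrict (closedBall (g₁ y) r)))) + ENNReal.ofReal ε := by
          rw [lintegral_add_right _ (by fun_prop), lintegral_mul_const _ (by fun_prop),
            lintegral_exp_neg_Ioi_zero, one_mul]
      _ ≤ _ := by gcongr; exact le_max_right _ _
end
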